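/- (Proposition 3.1(ii)) Let 1 ≤ j ≤ N and let 𝒜_j be a bounded linear operator on ℓ²(ℤ^N, ℂ^M) satisfying P_j 𝒜_j P_j = 𝒜_j, commuting with S_n for every n ∈ ℤ^N with n₁ = ⋯ = n_j = 0, and mapping every finitely supported function to a finitely supported function. Then the matrix symbol can be taken to be a trigonometric polynomial: there exist a finite set S ⊂ {0}^j × ℤ^{N-j} and constant M×M matrices A_j^{(n)}, n ∈ S, such that for all f̂ ∈ L²_M, (F 𝒜_j F^{-1} f̂)(k) = (Σ_{n∈S} e^{in·k} A_j^{(n)}) ⟨f̂⟩_{1…j}(k_{j+1},…,k_N) for a.e. k. -/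

import Mathlib

open MeasureTheory

noncomputable section

/-- The box `[-π, π]^N`. -/
def box (N : ℕ) : Set (Fin N → ℝ) := Set.univ.pi fun _ => Set.Icc (-Real.pi) Real.pi

/-- Lebesgue measure restricted to the box `[-π, π]^N`. -/
def boxMeasure (N : ℕ) : Measure (Fin N → ℝ) := MeasureTheory.volume.restrict (box N)

/-- `L²_M`: square-integrable `ℂ^M`-valued functions on `[-π, π]^N`. -/
abbrev L2M (N M : ℕ) : Type := MeasureTheory.Lp (EuclideanSpace ℂ (Fin M)) 2 (boxMeasure N)

/-- `ℓ²(ℤ^N, ℂ^M)`. -/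
abbrev ell2 (N M : ℕ) : Type := lp (fun _ : Fin N → ℤ => EuclideanSpace ℂ (Fin M)) 2

/-- The values of the Bloch–Floquet transform:
`(F h)(k) = (2π)^{-N/2} Σ_{n ∈ ℤ^N} h(n) e^{i n·k}`. -/
def blochFormula {N M : ℕ} (h : (Fin N → ℤ) → EuclideanSpace ℂ (Fin M)) (k : Fin N → ℝ) :
    EuclideanSpace ℂ (Fin M) :=
  ((2 * Real.pi) ^ ((N : ℝ) / 2))⁻¹ •
    ∑' n : Fin N → ℤ, Complex.exp (Complex.I * ∑ i, (n i : ℂ) * (k i : ℂ)) • h n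
/-- The (unnormalized) partial integral over the first `j` variables:
`(pint j f)(k) = ∫_{[-π,π]^j} f(t₁,…,t_j,k_{j+1},…,k_N) dt₁⋯dt_j`. -/
def pint {N M : ℕ} (j : ℕ) (f : (Fin N → ℝ) → EuclideanSpace ℂ (Fin M))
    (k : Fin N → ℝ) : EuclideanSpace ℂ (Fin M) :=
  ∫ t : Fin j → ℝ in (Set.univ.pi fun _ => Set.Icc (-Real.pi) Real.pi),
    f fun i => if h : (i : ℕ) < j then t ⟨(i : ℕ), h⟩ else k i

/-- The normalized partial average
`⟨f⟩_{1…j}(k) = (2π)^{-j/2} ∫_{[-π,π]^j} f(t₁,…,t_j,k_{j+1},…,k_N) dt₁⋯dt_j`. -/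
def navg {N M : ℕ} (j : ℕ) (f : (Fin N → ℝ) → EuclideanSpace ℂ (Fin M))
    (k : Fin N → ℝ) : EuclideanSpace ℂ (Fin M) :=
  ((2 * Real.pi) ^ ((j : ℝ) / 2))⁻¹ • pint j f k

/-- Replace the first `j` coordinates of `p.1` by `p.2`. -/
def overwrite {N : ℕ} (j : ℕ) (p : (Fin N → ℝ) × (Fin j → ℝ)) : Fin N → ℝ :=
  fun i => if h : (i : ℕ) < j then p.2 ⟨(i : ℕ), h⟩ else p.1 i

lemma measurable_overwrite {N : ℕ} (j : ℕ) : Measurable (overwrite (N := N) j) := by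
  refine measurable_pi_lambda _ fun i => ?_
  unfold overwrite
  by_cases h : (i : ℕ) < j <;> simp only [h, dite_true, dite_false] <;> fun_prop

lemma boxMeasure_eq_pi (N : ℕ) :
    boxMeasure N =
      Measure.pi fun _ : Fin N => volume.restrict (Set.Icc (-Real.pi) Real.pi) := by
  rw [boxMeasure, box, volume_pi, Measure.restrict_pi_pi]

instance (N : ℕ) : IsFiniteMeasure (boxMeasure N) := by
  rw [boxMeasure_eq_pi]; infer_instance

lemma map_overwrite {N j : ℕ} (hj : j ≤ N) :
    ((boxMeasure N).prod (boxMeasure j)).map (overwrite j) =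
      (ENNReal.ofReal (2 * Real.pi)) ^ j • boxMeasure N := by
  obtain ⟨d, rfl⟩ := Nat.exists_eq_add_of_le hj
  set c := ENNReal.ofReal (2 * Real.pi) with hc
  have hc0 : c ^ j ≠ 0 := pow_ne_zero _ (by simp [hc, Real.pi_pos])
  have hct : c ^ j ≠ ⊤ := ENNReal.pow_ne_top ENNReal.ofReal_ne_top
  have key : boxMeasure (j + d) =
      (c ^ j)⁻¹ • ((boxMeasure (j + d)).prod (boxMeasure j)).map (overwrite j) := by
    conv_lhs => rw [boxMeasure_eq_pi]
    refine Measure.pi_eq fun s hs => ?_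
    have hpre : overwrite j ⁻¹' (Set.univ.pi s) =
        (Set.univ.pi fun i : Fin (j + d) => if (i : ℕ) < j then Set.univ else s i) ×ˢ
          (Set.univ.pi fun i : Fin j => s (Fin.castAdd d i)) := by
      ext ⟨k, t⟩
      simp only [overwrite, Set.mem_preimage, Set.mem_pi, Set.mem_univ, true_implies,
        Set.mem_prod]
      constructor
      · intro h
        refine ⟨fun i => ?_, fun i => ?_⟩
        · by_cases hi : (i : ℕ) < j
          · simp [hi]
          · simpa [hi] using h i
        · simpa using h (Fin.castAdd d i)
      · rintro ⟨h1, h2⟩ i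
        by_cases hi : (i : ℕ) < j
        · simpa [hi] using h2 ⟨i, hi⟩
        · simpa [hi] using h1 i
    rw [Measure.smul_apply, Measure.map_apply (measurable_overwrite j) (.univ_pi hs), hpre,
      Measure.prod_prod, boxMeasure_eq_pi, boxMeasure_eq_pi, Measure.pi_pi, Measure.pi_pi,
      Fin.prod_univ_add, Fin.prod_univ_add]
    have hvol : volume (Set.Icc (-Real.pi) Real.pi) = c := by
      rw [Real.volume_Icc, hc]; congr 1; ring
    simp only [Fin.val_castAdd, Fin.is_lt, if_true, Fin.val_natAdd, Measure.restrict_apply_univ,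
      hvol, Finset.prod_const, Finset.card_univ, Fintype.card_fin, smul_eq_mul,
      not_lt.2 (Nat.le_add_right _ _), if_false]
    rw [mul_assoc, ← mul_assoc (c ^ j)⁻¹, ENNReal.inv_mul_cancel hc0 hct, one_mul, mul_comm]
  conv_rhs => rw [key]
  rw [smul_smul, ENNReal.mul_inv_cancel hc0 hct, one_smul]

lemma quasiMeasurePreserving_overwrite {N j : ℕ} (hj : j ≤ N) :
    Measure.QuasiMeasurePreserving (overwrite j) ((boxMeasure N).prod (boxMeasure j))
      (boxMeasure N) :=
  ⟨measurable_overwrite j, map_overwrite hj ▸ Measure.smul_absolutelyContinuous⟩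

lemma pint_eq_integral_overwrite {N M : ℕ} (j : ℕ) (f : (Fin N → ℝ) → EuclideanSpace ℂ (Fin M))
    (k : Fin N → ℝ) : pint j f k = ∫ t, f (overwrite j (k, t)) ∂boxMeasure j := rfl

lemma MeasureTheory.Integrable.comp_overwrite {N M j : ℕ} (hj : j ≤ N)
    {f : (Fin N → ℝ) → EuclideanSpace ℂ (Fin M)} (hf : Integrable f (boxMeasure N)) :
    ∀ᵐ k ∂boxMeasure N, Integrable (fun t => f (overwrite j (k, t))) (boxMeasure j) := by
  refine Integrable.prod_right_ae (f := f ∘ overwrite j) ?_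
  refine Integrable.comp_measurable ?_ (measurable_overwrite j)
  rw [map_overwrite hj]
  exact hf.smul_measure (ENNReal.pow_ne_top ENNReal.ofReal_ne_top)

lemma pint_congr_ae {N M j : ℕ} (hj : j ≤ N) {f g : (Fin N → ℝ) → EuclideanSpace ℂ (Fin M)}
    (h : f =ᵐ[boxMeasure N] g) : pint j f =ᵐ[boxMeasure N] pint j g := by
  filter_upwards [Measure.ae_ae_of_ae_prod ((quasiMeasurePreserving_overwrite hj).ae h)] with k hk
  exact integral_congr_ae hk

lemma pint_add_ae {N M j : ℕ} (hj : j ≤ N) {f g : (Fin N → ℝ) → EuclideanSpace ℂ (Fin M)}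
    (hf : Integrable f (boxMeasure N)) (hg : Integrable g (boxMeasure N)) :
    pint j (f + g) =ᵐ[boxMeasure N] pint j f + pint j g := by
  filter_upwards [hf.comp_overwrite hj, hg.comp_overwrite hj] with k hfk hgk
  exact integral_add hfk hgk

lemma aestronglyMeasurable_pint {N M j : ℕ} (hj : j ≤ N)
    {f : (Fin N → ℝ) → EuclideanSpace ℂ (Fin M)} (hf : AEStronglyMeasurable f (boxMeasure N)) :
    AEStronglyMeasurable (pint j f) (boxMeasure N) :=
  (hf.comp_quasiMeasurePreserving (quasiMeasurePreserving_overwrite hj)).integral_prod_right'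

lemma lintegral_enorm_pint_le {N M j : ℕ} (hj : j ≤ N)
    {f : (Fin N → ℝ) → EuclideanSpace ℂ (Fin M)} (hf : AEStronglyMeasurable f (boxMeasure N)) :
    ∫⁻ k, ‖pint j f k‖ₑ ∂boxMeasure N ≤
      ENNReal.ofReal (2 * Real.pi) ^ j * ∫⁻ k, ‖f k‖ₑ ∂boxMeasure N := by
  have hmeas := (hf.comp_quasiMeasurePreserving (quasiMeasurePreserving_overwrite hj)).enorm
  calc ∫⁻ k, ‖pint j f k‖ₑ ∂boxMeasure N
      ≤ ∫⁻ k, ∫⁻ t, ‖f (overwrite j (k, t))‖ₑ ∂boxMeasure j ∂boxMeasure N :=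
        lintegral_mono fun k => enorm_integral_le_lintegral_enorm _
    _ = ∫⁻ p, ‖f (overwrite j p)‖ₑ ∂(boxMeasure N).prod (boxMeasure j) :=
        (lintegral_prod _ hmeas).symm
    _ = ∫⁻ k, ‖f k‖ₑ ∂((boxMeasure N).prod (boxMeasure j)).map (overwrite j) := by
        refine (lintegral_map' (f := fun k => ‖f k‖ₑ) ?_
          (measurable_overwrite j).aemeasurable).symm
        rw [map_overwrite hj]
        exact hf.enorm.smul_measure _
    _ = _ := by rw [map_overwrite hj, lintegral_smul_measure, smul_eq_mul]

lemma integral_exp_int_mul_Icc (m : ℤ) :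
    ∫ t : ℝ in Set.Icc (-Real.pi) Real.pi, Complex.exp (Complex.I * ((m : ℂ) * (t : ℂ))) =
      if m = 0 then 2 * (Real.pi : ℂ) else 0 := by
  have hle : -Real.pi ≤ Real.pi := by linarith [Real.pi_pos]
  rw [integral_Icc_eq_integral_Ioc, ← intervalIntegral.integral_of_le hle]
  split_ifs with hm
  · subst hm
    simp
    ring
  · have hc : Complex.I * (m : ℂ) ≠ 0 := by simp [hm]
    simp_rw [← mul_assoc]
    rw [integral_exp_mul_complex hc, div_eq_zero_iff]
    left
    rw [sub_eq_zero, Complex.exp_eq_exp_iff_exists_int]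
    exact ⟨m, by push_cast; ring⟩

lemma pint_exp_smul {N M j : ℕ} (hj : j ≤ N) (n : Fin N → ℤ) (v : EuclideanSpace ℂ (Fin M))
    (k : Fin N → ℝ) :
    pint j (fun k => Complex.exp (Complex.I * ∑ i, (n i : ℂ) * (k i : ℂ)) • v) k =
      if ∀ i : Fin N, (i : ℕ) < j → n i = 0 then
        ((2 * Real.pi : ℂ) ^ j * Complex.exp (Complex.I * ∑ i, (n i : ℂ) * (k i : ℂ))) • v
      else 0 := by
  obtain ⟨d, rfl⟩ := Nat.exists_eq_add_of_le hj
  have hsplit : ∀ t : Fin j → ℝ,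
      Complex.exp (Complex.I * ∑ i, (n i : ℂ) * (overwrite j (k, t) i : ℂ)) =
        (∏ i : Fin j, Complex.exp (Complex.I * ((n (Fin.castAdd d i) : ℂ) * (t i : ℂ)))) *
          Complex.exp (Complex.I * ∑ i : Fin d, (n (Fin.natAdd j i) : ℂ) *
            (k (Fin.natAdd j i) : ℂ)) := by
    intro t
    rw [Fin.sum_univ_add, mul_add, Complex.exp_add, Finset.mul_sum, Complex.exp_sum]
    simp [overwrite]
  rw [pint_eq_integral_overwrite, integral_smul_const]
  simp_rw [hsplit]
  rw [integral_mul_const, boxMeasure_eq_pi,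
    integral_fintype_prod_eq_prod
      (fun (i : Fin j) (t : ℝ) => Complex.exp (Complex.I * ((n (Fin.castAdd d i) : ℂ) * (t : ℂ))))]
  simp_rw [integral_exp_int_mul_Icc]
  split_ifs with h
  · have h' : ∀ i : Fin j, n (Fin.castAdd d i) = 0 := fun i => h _ (by simp)
    simp [h', Fin.sum_univ_add]
  · push Not at h
    obtain ⟨i, hi, hni⟩ := h
    rw [Finset.prod_eq_zero (Finset.mem_univ (⟨i, hi⟩ : Fin j)), zero_mul, zero_smul]
    exact if_neg hni

lemma navg_Lp_add_ae {N M j : ℕ} (hj : j ≤ N) (f g : L2M N M) :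
    navg j ⇑(f + g) =ᵐ[boxMeasure N] fun k => navg j ⇑f k + navg j ⇑g k := by
  have hint : ∀ f : L2M N M, Integrable f (boxMeasure N) :=
    fun f => (Lp.memLp f).integrable (by norm_num)
  filter_upwards [pint_congr_ae hj (Lp.coeFn_add f g), pint_add_ae hj (hint f) (hint g)]
    with k h1 h2
  rw [navg, h1, h2, Pi.add_apply, smul_add]
  rfl

lemma aestronglyMeasurable_navg {N M j : ℕ} (hj : j ≤ N)
    {f : (Fin N → ℝ) → EuclideanSpace ℂ (Fin M)} (hf : AEStronglyMeasurable f (boxMeasure N)) :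
    AEStronglyMeasurable (navg j f) (boxMeasure N) :=
  (aestronglyMeasurable_pint hj hf).const_smul ((2 * Real.pi) ^ ((j : ℝ) / 2))⁻¹

lemma lintegral_enorm_Lp_two_le {N M : ℕ} (f : L2M N M) :
    ∫⁻ k, ‖f k‖ₑ ∂boxMeasure N ≤ ‖f‖ₑ * boxMeasure N Set.univ ^ (1 / 2 : ℝ) := by
  have h := eLpNorm_le_eLpNorm_mul_rpow_measure_univ (p := 1) (q := 2) (by norm_num)
    (Lp.aestronglyMeasurable f)
  rw [eLpNorm_one_eq_lintegral_enorm, ← Lp.enorm_def] at h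
  convert h using 3
  norm_num

/-- Two continuous operators on `ℓ²` related by a bounded continuous symbol and partial averaging
on every one-site function are so related on all of `ℓ²`. -/
lemma ae_eq_symbol_navg_of_single {N M j : ℕ} (hj : j ≤ N) (U V : ell2 N M →L[ℂ] L2M N M)
    (B : (Fin N → ℝ) → EuclideanSpace ℂ (Fin M) →L[ℂ] EuclideanSpace ℂ (Fin M))
    (hB : Continuous B) (C : ℝ) (hBC : ∀ k, ‖B k‖ ≤ C)
    (hsingle : ∀ n v, ⇑(U (lp.single 2 n v)) =ᵐ[boxMeasure N]
      fun k => B k (navg j ⇑(V (lp.single 2 n v)) k))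
    (h : ell2 N M) :
    ⇑(U h) =ᵐ[boxMeasure N] fun k => B k (navg j ⇑(V h) k) := by
  have hadd : ∀ g g' : ell2 N M,
      (fun k => U (g + g') k - B k (navg j ⇑(V (g + g')) k)) =ᵐ[boxMeasure N]
        fun k => (U g k - B k (navg j ⇑(V g) k)) + (U g' k - B k (navg j ⇑(V g') k)) := by
    intro g g'
    rw [map_add, map_add]
    filter_upwards [Lp.coeFn_add (U g) (U g'), navg_Lp_add_ae hj (V g) (V g')] with k h1 h2
    rw [h1, h2, Pi.add_apply, map_add]
    abel
  have hmeas : ∀ g : ell2 N M,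
      AEStronglyMeasurable (fun k => B k (navg j ⇑(V g) k)) (boxMeasure N) := fun g =>
    isBoundedBilinearMap_apply.continuous.comp_aestronglyMeasurable
      (hB.aestronglyMeasurable.prodMk
        (aestronglyMeasurable_navg hj (Lp.aestronglyMeasurable (V g))))
  have hBC' : ∀ k, ‖B k‖ₑ ≤ ENNReal.ofReal C := fun k => by
    rw [← ofReal_norm]
    exact ENNReal.ofReal_le_ofReal (hBC k)
  have hC : ENNReal.ofReal C ≠ ⊤ := ENNReal.ofReal_ne_top
  generalize ENNReal.ofReal C = C' at hBC' hC
  set D := boxMeasure N Set.univ ^ (1 / 2 : ℝ) with hD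
  have hDtop : D ≠ ⊤ := ENNReal.rpow_ne_top_of_nonneg (by norm_num) (measure_ne_top _ _)
  set c := ‖((2 * Real.pi) ^ ((j : ℝ) / 2))⁻¹‖ₑ with hc
  set K := ‖U‖ₑ * D + C' * (c * (ENNReal.ofReal (2 * Real.pi) ^ j * (‖V‖ₑ * D))) with hK
  have hKtop : K ≠ ⊤ := by
    refine ENNReal.add_ne_top.2 ⟨ENNReal.mul_ne_top enorm_ne_top hDtop, ?_⟩
    exact ENNReal.mul_ne_top hC (ENNReal.mul_ne_top enorm_ne_top (ENNReal.mul_ne_top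
      (ENNReal.pow_ne_top ENNReal.ofReal_ne_top) (ENNReal.mul_ne_top enorm_ne_top hDtop)))
  have hbound : ∀ g : ell2 N M,
      ∫⁻ k, ‖U g k - B k (navg j ⇑(V g) k)‖ₑ ∂boxMeasure N ≤ K * ‖g‖ₑ := by
    intro g
    have hU : ∫⁻ k, ‖U g k‖ₑ ∂boxMeasure N ≤ ‖U‖ₑ * ‖g‖ₑ * D :=
      (lintegral_enorm_Lp_two_le _).trans (by gcongr; exact U.le_opENorm g)
    have hV : ∫⁻ k, ‖V g k‖ₑ ∂boxMeasure N ≤ ‖V‖ₑ * ‖g‖ₑ * D :=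
      (lintegral_enorm_Lp_two_le _).trans (by gcongr; exact V.le_opENorm g)
    have hct : c ≠ ⊤ := enorm_ne_top
    calc ∫⁻ k, ‖U g k - B k (navg j ⇑(V g) k)‖ₑ ∂boxMeasure N
        ≤ ∫⁻ k, (‖U g k‖ₑ + C' * (c * ‖pint j ⇑(V g) k‖ₑ)) ∂boxMeasure N := by
          refine lintegral_mono fun k => enorm_sub_le.trans ?_
          gcongr
          refine ((B k).le_opENorm _).trans ?_
          rw [navg, enorm_smul]
          gcongr
          exact hBC' k
      _ = ∫⁻ k, ‖U g k‖ₑ ∂boxMeasure N +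
            C' * (c * ∫⁻ k, ‖pint j ⇑(V g) k‖ₑ ∂boxMeasure N) := by
          rw [lintegral_add_left' (Lp.aestronglyMeasurable _).enorm, lintegral_const_mul' _ _ hC,
            lintegral_const_mul' _ _ hct]
      _ ≤ ‖U‖ₑ * ‖g‖ₑ * D +
            C' * (c * (ENNReal.ofReal (2 * Real.pi) ^ j * (‖V‖ₑ * ‖g‖ₑ * D))) := by
          gcongr
          refine (lintegral_enorm_pint_le hj (Lp.aestronglyMeasurable _)).trans ?_
          gcongr
      _ = K * ‖g‖ₑ := by rw [hK]; ring
  have hfinset : ∀ s : Finset (Fin N → ℤ),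
      (fun k => U (∑ n ∈ s, lp.single 2 n (h n)) k -
        B k (navg j ⇑(V (∑ n ∈ s, lp.single 2 n (h n))) k)) =ᵐ[boxMeasure N] 0 := by
    intro s
    induction s using Finset.cons_induction with
    | empty =>
      filter_upwards [hsingle 0 0] with k hk
      simpa [sub_eq_zero] using hk
    | cons n s hn ih =>
      rw [Finset.sum_cons]
      filter_upwards [hadd (lp.single 2 n (h n)) (∑ n ∈ s, lp.single 2 n (h n)), ih,
        hsingle n (h n)] with k h1 h2 h3
      rw [h1, h2, h3, sub_self]
      exact add_zero _
  have hle : ∀ s : Finset (Fin N → ℤ),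
      ∫⁻ k, ‖U h k - B k (navg j ⇑(V h) k)‖ₑ ∂boxMeasure N ≤
        K * ‖h - ∑ n ∈ s, lp.single 2 n (h n)‖ₑ := by
    intro s
    refine le_trans (le_of_eq (lintegral_congr_ae ?_)) (hbound _)
    have := hadd (h - ∑ n ∈ s, lp.single 2 n (h n)) (∑ n ∈ s, lp.single 2 n (h n))
    rw [sub_add_cancel] at this
    filter_upwards [this, hfinset s] with k h1 h2
    rw [h1, h2, Pi.zero_apply, add_zero]
  have hlim : Filter.Tendsto (fun s : Finset (Fin N → ℤ) =>
      K * ‖h - ∑ n ∈ s, lp.single 2 n (h n)‖ₑ) Filter.atTop (nhds 0) := by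
    have h1 : Filter.Tendsto (fun s : Finset (Fin N → ℤ) => h - ∑ n ∈ s, lp.single 2 n (h n))
        Filter.atTop (nhds (h - h)) := (lp.hasSum_single (by norm_num) h).const_sub h
    have h2 := ENNReal.Tendsto.const_mul (a := K) h1.enorm (Or.inr hKtop)
    simpa using h2
  have hzero := le_antisymm (ge_of_tendsto' hlim hle) zero_le
  have hdiff := ((Lp.aestronglyMeasurable (U h)).sub (hmeas h)).enorm
  filter_upwards [(lintegral_eq_zero_iff' hdiff).1 hzero] with k hk
  exact sub_eq_zero.1 (enorm_eq_zero.1 hk)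

lemma blochFormula_single {N M : ℕ} (n : Fin N → ℤ) (v : EuclideanSpace ℂ (Fin M))
    (k : Fin N → ℝ) :
    blochFormula ⇑(lp.single 2 n v : ell2 N M) k =
      Complex.exp (Complex.I * ∑ i, (n i : ℂ) * (k i : ℂ)) •
        ((2 * Real.pi) ^ ((N : ℝ) / 2))⁻¹ • v := by
  rw [blochFormula, tsum_eq_single n, lp.single_apply_self, smul_comm]
  intro m hm
  rw [lp.single_apply_ne _ _ _ hm, smul_zero]

lemma finite_support_single {N M : ℕ} (n : Fin N → ℤ) (v : EuclideanSpace ℂ (Fin M)) :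
    (Function.support ⇑(lp.single 2 n v : ell2 N M)).Finite := by
  refine (Set.finite_singleton n).subset fun m hm => ?_
  by_contra hne
  exact hm (lp.single_apply_ne _ _ _ hne)

lemma navg_exp_smul {N M j : ℕ} (hj : j ≤ N) (n : Fin N → ℤ) (v : EuclideanSpace ℂ (Fin M))
    (k : Fin N → ℝ) :
    navg j (fun k => Complex.exp (Complex.I * ∑ i, (n i : ℂ) * (k i : ℂ)) • v) k =
      if ∀ i : Fin N, (i : ℕ) < j → n i = 0 then
        Complex.exp (Complex.I * ∑ i, (n i : ℂ) * (k i : ℂ)) •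
          ((2 * Real.pi) ^ ((j : ℝ) / 2)) • v
      else 0 := by
  rw [navg, pint_exp_smul hj]
  split_ifs
  · have hpos : 0 < 2 * Real.pi := by positivity
    have hpow : (2 * Real.pi) ^ j =
        (2 * Real.pi) ^ ((j : ℝ) / 2) * (2 * Real.pi) ^ ((j : ℝ) / 2) := by
      rw [← Real.rpow_add hpos, add_halves, Real.rpow_natCast]
    have hcast : (2 * Real.pi : ℂ) ^ j = (((2 * Real.pi) ^ j : ℝ) : ℂ) := by push_cast; rfl
    rw [hcast, hpow, mul_smul, Complex.coe_smul, mul_smul, inv_smul_smul₀ (by positivity),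
      smul_comm]
  · exact smul_zero _

/-- Proposition 3.1(ii): if in addition `𝒜_j` maps finitely supported
functions to finitely supported functions, the symbol may be taken to be a matrix
trigonometric polynomial supported on the sublattice: there are a finite set
`S ⊂ {0}^j × ℤ^{N-j}` and constant matrices `A_j^{(n)}` with
`(F 𝒜_j F⁻¹ f̂)(k) = (Σ_{n ∈ S} e^{i n·k} A_j^{(n)}) ⟨f̂⟩_{1…j}` for a.e. `k`. -/
theorem sublattice_finite_periodic_operator_symbol_trig_poly (N M : ℕ) (hN : 0 < N) (hM : 0 < M)
    (j : ℕ) (hj1 : 1 ≤ j) (hjN : j ≤ N)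
    (F : ell2 N M ≃ₗᵢ[ℂ] L2M N M)
    (hF : ∀ h : ell2 N M, (Function.support ⇑h).Finite →
      ⇑(F h) =ᵐ[boxMeasure N] blochFormula ⇑h)
    (T : ell2 N M →L[ℂ] ell2 N M)
    (hrange : ∀ (h : ell2 N M) (n : Fin N → ℤ),
      ¬ (∀ i : Fin N, (i : ℕ) < j → n i = 0) → (T h) n = 0)
    (hTP : ∀ h g : ell2 N M,
      (∀ n : Fin N → ℤ, g n = if ∀ i : Fin N, (i : ℕ) < j → n i = 0 then h n else 0) →
      T g = T h)
    (hshift : ∀ n : Fin N → ℤ, (∀ i : Fin N, (i : ℕ) < j → n i = 0) →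
      ∀ f g : ell2 N M, (∀ m, g m = f (m + n)) → ∀ m, (T g) m = (T f) (m + n))
    (hfin : ∀ h : ell2 N M, (Function.support ⇑h).Finite →
      (Function.support ⇑(T h)).Finite) :
    ∃ (S : Finset (Fin N → ℤ)) (Amat : (Fin N → ℤ) → Matrix (Fin M) (Fin M) ℂ),
      (∀ n ∈ S, ∀ i : Fin N, (i : ℕ) < j → n i = 0) ∧
      ∀ f : L2M N M, ∀ᵐ k ∂(boxMeasure N), ∀ a : Fin M,
        (F (T (F.symm f))) k a =
          ∑ b : Fin M,
            (∑ n ∈ S, Complex.exp (Complex.I * ∑ i, (n i : ℂ) * (k i : ℂ)) * Amat n a b)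
              * navg j (⇑f) k b := by
  classical
  let T₀ (n : Fin N → ℤ) : EuclideanSpace ℂ (Fin M) →L[ℂ] EuclideanSpace ℂ (Fin M) :=
    LinearMap.toContinuousLinearMap
      { toFun := fun v => T (lp.single 2 0 v) n
        map_add' := fun v w => by rw [lp.single_add, map_add]; rfl
        map_smul' := fun c v => by rw [lp.single_smul, map_smul]; rfl }
  have hT₀ : ∀ n v, T₀ n v = T (lp.single 2 0 v) n := fun _ _ => rfl
  have hbasis : ∀ v : EuclideanSpace ℂ (Fin M), v = ∑ b, v b • EuclideanSpace.single b (1 : ℂ) := by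
    intro v
    ext a
    simp [Pi.single_apply]
  let S : Finset (Fin N → ℤ) := Finset.univ.biUnion fun b : Fin M =>
    (hfin (lp.single 2 0 (EuclideanSpace.single b 1)) (finite_support_single _ _)).toFinset
  have hS : ∀ n ∉ S, ∀ v, T₀ n v = 0 := by
    intro n hn v
    rw [hbasis v, map_sum]
    refine Finset.sum_eq_zero fun b _ => ?_
    rw [map_smul, hT₀]
    simp only [S, Finset.mem_biUnion, Finset.mem_univ, true_and, Set.Finite.mem_toFinset,
      Function.mem_support, not_exists, not_not] at hn
    rw [hn b, smul_zero]
  let A (n : Fin N → ℤ) : EuclideanSpace ℂ (Fin M) →L[ℂ] EuclideanSpace ℂ (Fin M) :=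
    ((2 * Real.pi) ^ ((j : ℝ) / 2))⁻¹ • T₀ n
  let B (k : Fin N → ℝ) : EuclideanSpace ℂ (Fin M) →L[ℂ] EuclideanSpace ℂ (Fin M) :=
    ∑ n ∈ S, Complex.exp (Complex.I * ∑ i, (n i : ℂ) * (k i : ℂ)) • A n
  have hB : Continuous B := by fun_prop
  have hBC : ∀ k, ‖B k‖ ≤ ∑ n ∈ S, ‖A n‖ := by
    intro k
    refine norm_sum_le_of_le S fun n _ => ?_
    have hexp : ‖Complex.exp (Complex.I * ∑ i, (n i : ℂ) * (k i : ℂ))‖ = 1 := by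
      have : Complex.I * ∑ i, (n i : ℂ) * (k i : ℂ) =
          ((∑ i, (n i : ℝ) * k i : ℝ) : ℂ) * Complex.I := by push_cast; ring
      rw [this, Complex.norm_exp_ofReal_mul_I]
    rw [norm_smul, hexp, one_mul]
  have hsingle : ∀ n v, ⇑(F (T (lp.single 2 n v))) =ᵐ[boxMeasure N]
      fun k => B k (navg j ⇑(F (lp.single 2 n v)) k) := by
    intro n v
    have hFn : ⇑(F (lp.single 2 n v)) =ᵐ[boxMeasure N] fun k =>
        Complex.exp (Complex.I * ∑ i, (n i : ℂ) * (k i : ℂ)) •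
          ((2 * Real.pi) ^ ((N : ℝ) / 2))⁻¹ • v :=
      (hF _ (finite_support_single n v)).trans
        (Filter.Eventually.of_forall fun k => blochFormula_single n v k)
    have havg : navg j ⇑(F (lp.single 2 n v)) =ᵐ[boxMeasure N] navg j fun k =>
        Complex.exp (Complex.I * ∑ i, (n i : ℂ) * (k i : ℂ)) •
          ((2 * Real.pi) ^ ((N : ℝ) / 2))⁻¹ • v := by
      filter_upwards [pint_congr_ae hjN hFn] with k hk
      rw [navg, hk, navg]
    by_cases hn : ∀ i : Fin N, (i : ℕ) < j → n i = 0
    · have hTn : ∀ m, T (lp.single 2 n v) m = T₀ (m + -n) v := by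
        refine hshift (-n) (fun i hi => by simp [hn i hi]) _ _ fun m => ?_
        by_cases hm : m = n
        · subst hm
          rw [add_neg_cancel, lp.single_apply_self, lp.single_apply_self]
        · rw [lp.single_apply_ne _ _ _ hm, lp.single_apply_ne _ _ _]
          rwa [← sub_eq_add_neg, sub_ne_zero]
      filter_upwards [havg, hF _ (hfin _ (finite_support_single n v))] with k h1 h2
      rw [h1, h2, navg_exp_smul hjN, if_pos hn, blochFormula]
      simp_rw [hTn]
      rw [← (Equiv.addRight n).tsum_eq, tsum_eq_sum (s := S)]
      · simp only [B, A, Equiv.coe_addRight, add_neg_cancel_right, _root_.sum_apply,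
          _root_.smul_apply, map_smul, Finset.smul_sum]
        refine Finset.sum_congr rfl fun m _ => ?_
        have hexp : Complex.exp (Complex.I * ∑ i, ((m + n) i : ℂ) * (k i : ℂ)) =
            Complex.exp (Complex.I * ∑ i, (m i : ℂ) * (k i : ℂ)) *
              Complex.exp (Complex.I * ∑ i, (n i : ℂ) * (k i : ℂ)) := by
          rw [← Complex.exp_add, ← mul_add, ← Finset.sum_add_distrib]
          simp [add_mul]
        have hpos : (2 * Real.pi) ^ ((j : ℝ) / 2) ≠ 0 := by positivity
        rw [ContinuousLinearMap.map_smul_of_tower, ContinuousLinearMap.map_smul_of_tower,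
          inv_smul_smul₀ hpos, hexp, smul_comm (Complex.exp _) (_ : ℝ) (T₀ m v),
          smul_comm (Complex.exp _) (_ : ℝ), smul_smul (Complex.exp _) (Complex.exp _),
          mul_comm (Complex.exp _)]
      · intro m hm
        rw [Equiv.coe_addRight, add_neg_cancel_right, hS m hm, smul_zero]
    · have hT : T (lp.single 2 n v) = 0 := by
        rw [← hTP _ 0 fun m => ?_, map_zero]
        split_ifs with hm
        · rw [lp.single_apply_ne]
          · rfl
          · rintro rfl
            exact hn hm
        · rfl
      rw [hT, map_zero]
      filter_upwards [havg, Lp.coeFn_zero (EuclideanSpace ℂ (Fin M)) 2 (boxMeasure N)]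
        with k h1 h2
      rw [h1, h2, navg_exp_smul hjN, if_neg hn, map_zero]
      rfl
  refine ⟨S, fun n a b => A n (EuclideanSpace.single b 1) a, ?_, fun f => ?_⟩
  · intro n hn
    simp only [S, Finset.mem_biUnion, Finset.mem_univ, true_and, Set.Finite.mem_toFinset,
      Function.mem_support] at hn
    obtain ⟨b, hb⟩ := hn
    by_contra hne
    exact hb (hrange _ n hne)
  · have := ae_eq_symbol_navg_of_single hjN
      ((F : ell2 N M →L[ℂ] L2M N M).comp T) (F : ell2 N M →L[ℂ] L2M N M) B hB _ hBC hsingle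
      (F.symm f)
    filter_upwards [this] with k hk a
    have hk' : F (T (F.symm f)) k = B k (navg j ⇑f k) := by
      simpa using hk
    rw [hk']
    conv_lhs => rw [hbasis (navg j ⇑f k)]
    simp only [map_sum, map_smul, B, _root_.sum_apply,
      _root_.smul_apply, WithLp.ofLp_sum, WithLp.ofLp_smul, Finset.sum_apply,
      Pi.smul_apply, smul_eq_mul]
    exact Finset.sum_congr rfl fun b _ => mul_comm _ _
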